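/- The Brocard axis of the incircle-CCP solutions and the three Brocard axes of the excircle-CCP solutions concur at the de Longchamps point of the reference triangle: the point X20 = 2•O − H (the reflection of the orthocenter H of ABC through the circumcenter O of ABC) lies on the line through the incenter I = [a:b:c] and the Gergonne point Ge = [1/(s−a) : 1/(s−b) : 1/(s−c)] of ABC, and also on each of the three lines through E_A = [−a:b:c] and G_A = [(b−s)(c−s) : (b−s)s : (c−s)s], through E_B = [a:−b:c] and G_B = [(a−s)s : (c−s)(a−s) : (c−s)s], and through E_C = [a:b:−c] and G_C = [(a−s)s : (b−s)s : (a−s)(b−s)] (all barycentric coordinates with respect to (A,B,C)). -/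

import Mathlib

open EuclideanGeometry

/-- The point with barycentric coordinates `[x : y : z]` with respect to `(A, B, C)`. -/
noncomputable def bary (A B C : EuclideanSpace ℝ (Fin 2)) (x y z : ℝ) :
    EuclideanSpace ℝ (Fin 2) :=
  (x + y + z)⁻¹ • (x • A + y • B + z • C)

lemma bary_smul (A B C : EuclideanSpace ℝ (Fin 2)) {k : ℝ} (hk : k ≠ 0) (x y z : ℝ) :
    bary A B C (k * x) (k * y) (k * z) = bary A B C x y z := by
  have h : k * x + k * y + k * z = k * (x + y + z) := by ring
  simp only [bary, h, mul_smul k, ← smul_add, mul_inv]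
  rw [smul_smul, mul_right_comm, inv_mul_cancel₀ hk, one_mul]

lemma dist_lt_add_of_not_collinear {A B C : EuclideanSpace ℝ (Fin 2)}
    (h : ¬ Collinear ℝ {A, B, C}) : dist A C < dist A B + dist B C :=
  dist_lt_dist_add_dist_iff.2 fun hw => h hw.collinear

lemma sq_dist_eq (P Q : EuclideanSpace ℝ (Fin 2)) :
    dist P Q ^ 2 = (P 0 - Q 0) ^ 2 + (P 1 - Q 1) ^ 2 := by
  rw [EuclideanSpace.dist_eq, Real.sq_sqrt (by positivity), Fin.sum_univ_two, Real.dist_eq,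
    Real.dist_eq, sq_abs, sq_abs]

/-- Barycentric coordinates of a point equidistant from three points, where `a`, `b`, `c` are the
side lengths up to sign and `K` is sixteen times the squared area. -/
lemma smul_eq_of_equidistant {A B C O : EuclideanSpace ℝ (Fin 2)} {a b c K : ℝ}
    (ha : a ^ 2 = dist B C ^ 2) (hb : b ^ 2 = dist C A ^ 2) (hc : c ^ 2 = dist A B ^ 2)
    (hK : K = (a + b + c) * (-a + b + c) * (a - b + c) * (a + b - c)) (hK0 : K ≠ 0)
    (hAB : dist A O = dist B O) (hAC : dist A O = dist C O) :
    K • O = (a ^ 2 * (b ^ 2 + c ^ 2 - a ^ 2)) • A + (b ^ 2 * (c ^ 2 + a ^ 2 - b ^ 2)) • B +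
      (c ^ 2 * (a ^ 2 + b ^ 2 - c ^ 2)) • C := by
  have hAB' : dist A O ^ 2 = dist B O ^ 2 := by rw [hAB]
  have hAC' : dist A O ^ 2 = dist C O ^ 2 := by rw [hAC]
  rw [sq_dist_eq] at ha hb hc
  rw [sq_dist_eq, sq_dist_eq] at hAB' hAC'
  have hK' : K = 2 * a ^ 2 * b ^ 2 + 2 * b ^ 2 * c ^ 2 + 2 * c ^ 2 * a ^ 2 -
      (a ^ 2) ^ 2 - (b ^ 2) ^ 2 - (c ^ 2) ^ 2 := by rw [hK]; ring
  set D := (B 0 - A 0) * (C 1 - A 1) - (B 1 - A 1) * (C 0 - A 0) with hD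
  have hKD : K = 4 * D ^ 2 := by
    rw [hK', ha, hb, hc, hD]; ring
  have hD0 : D ≠ 0 := by
    rintro h
    exact hK0 (by rw [hKD, h]; ring)
  have h0 : 2 * D * (O 0 - A 0) = ((B 0 - A 0) ^ 2 + (B 1 - A 1) ^ 2) * (C 1 - A 1) -
      ((C 0 - A 0) ^ 2 + (C 1 - A 1) ^ 2) * (B 1 - A 1) := by
    rw [hD]; linear_combination (C 1 - A 1) * hAB' - (B 1 - A 1) * hAC'
  have h1 : 2 * D * (O 1 - A 1) = ((C 0 - A 0) ^ 2 + (C 1 - A 1) ^ 2) * (B 0 - A 0) -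
      ((B 0 - A 0) ^ 2 + (B 1 - A 1) ^ 2) * (C 0 - A 0) := by
    rw [hD]; linear_combination (B 0 - A 0) * hAC' - (C 0 - A 0) * hAB'
  ext i
  fin_cases i
  · simp only [Fin.zero_eta, PiLp.add_apply, PiLp.smul_apply, smul_eq_mul]
    rw [hKD, ha, hb, hc]
    linear_combination 2 * D * h0
  · simp only [Fin.mk_one, PiLp.add_apply, PiLp.smul_apply, smul_eq_mul]
    rw [hKD, ha, hb, hc]
    linear_combination 2 * D * h1

/-- The de Longchamps point `4 • O - (A + B + C)` lies on the line through `[a : b : c]` and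
`[yz : zx : xy]`, where `2x = b + c - a` and cyclically. -/
lemma deLongchamps_mem_affineSpan_pair {A B C O : EuclideanSpace ℝ (Fin 2)} {a b c s x y z : ℝ}
    (hx : a = y + z) (hy : b = z + x) (hz : c = x + y) (hs : s = x + y + z)
    (hs0 : s ≠ 0) (hx0 : x ≠ 0) (hy0 : y ≠ 0) (hz0 : z ≠ 0) (hσ : x * y + y * z + z * x ≠ 0)
    (ha : a ^ 2 = dist B C ^ 2) (hb : b ^ 2 = dist C A ^ 2) (hc : c ^ 2 = dist A B ^ 2)
    (hAB : dist A O = dist B O) (hAC : dist A O = dist C O) :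
    (4 : ℝ) • O - (A + B + C) ∈ affineSpan ℝ
      ({bary A B C a b c, bary A B C (y * z) (z * x) (x * y)} :
        Set (EuclideanSpace ℝ (Fin 2))) := by
  have hK0 : 16 * s * x * y * z ≠ 0 := by positivity
  have hO := smul_eq_of_equidistant (K := 16 * s * x * y * z) ha hb hc
    (by subst hx hy hz hs; ring) hK0 hAB hAC
  rw [← eq_inv_smul_iff₀ hK0] at hO
  convert AffineMap.lineMap_mem_affineSpan_pair
    (-(s * (x * y + y * z + z * x)) / (x * y * z)) _ _ using 1
  have hsum : a + b + c = 2 * s := by subst hx hy hz hs; ring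
  have hsum' : y * z + z * x + x * y = x * y + y * z + z * x := by ring
  rw [AffineMap.lineMap_apply_module, hO, bary, bary, hsum, hsum']
  generalize hσ' : x * y + y * z + z * x = σ at hσ ⊢
  match_scalars <;> (field_simp; subst hx hy hz hs hσ'; ring)

lemma four_smul_circumcenter_sub (T : Affine.Triangle ℝ (EuclideanSpace ℝ (Fin 2))) :
    (2 : ℝ) • T.circumcenter - T.orthocenter =
      (4 : ℝ) • T.circumcenter - (T.points 0 + T.points 1 + T.points 2) := by
  have h : T.orthocenter - T.circumcenter = ∑ i : Fin 3, (T.points i - T.circumcenter) :=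
    T.orthocenter_vsub_circumcenter_eq_sum_vsub
  rw [Fin.sum_univ_three] at h
  rw [eq_add_of_sub_eq h]
  module

/-- The Brocard axis of the incircle-CCP solutions (the line through the incenter `I` and
the Gergonne point `Ge` of `ABC`) and the three Brocard axes of the excircle-CCP
solutions (the lines through each excenter and the corresponding exversion of the
Gergonne point) concur at the de Longchamps point `X20 = 2•O − H` of the reference
triangle. -/
theorem ccp_brocard_axes_concur_de_longchamps
    (A B C : EuclideanSpace ℝ (Fin 2)) (hABC : AffineIndependent ℝ ![A, B, C])
    (a b c s : ℝ)
    (ha : a = dist B C) (hb : b = dist C A) (hc : c = dist A B)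
    (hs : s = (a + b + c) / 2)
    (O H X20 : EuclideanSpace ℝ (Fin 2))
    (hO : O = (⟨![A, B, C], hABC⟩ : Affine.Triangle ℝ (EuclideanSpace ℝ (Fin 2))).circumcenter)
    (hH : H = Affine.Triangle.orthocenter (⟨![A, B, C], hABC⟩ : Affine.Triangle ℝ (EuclideanSpace ℝ (Fin 2))))
    (hX20 : X20 = (2 : ℝ) • O - H)
    (I Ge : EuclideanSpace ℝ (Fin 2))
    (hI : I = bary A B C a b c)
    (hGe : Ge = bary A B C (1 / (s - a)) (1 / (s - b)) (1 / (s - c)))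
    (EA EB EC GA GB GC : EuclideanSpace ℝ (Fin 2))
    (hEA : EA = bary A B C (-a) b c)
    (hEB : EB = bary A B C a (-b) c)
    (hEC : EC = bary A B C a b (-c))
    (hGA : GA = bary A B C ((b - s) * (c - s)) ((b - s) * s) ((c - s) * s))
    (hGB : GB = bary A B C ((a - s) * s) ((c - s) * (a - s)) ((c - s) * s))
    (hGC : GC = bary A B C ((a - s) * s) ((b - s) * s) ((a - s) * (b - s))) :
    X20 ∈ affineSpan ℝ ({I, Ge} : Set (EuclideanSpace ℝ (Fin 2))) ∧
    X20 ∈ affineSpan ℝ ({EA, GA} : Set (EuclideanSpace ℝ (Fin 2))) ∧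
    X20 ∈ affineSpan ℝ ({EB, GB} : Set (EuclideanSpace ℝ (Fin 2))) ∧
    X20 ∈ affineSpan ℝ ({EC, GC} : Set (EuclideanSpace ℝ (Fin 2))) := by
  have hdist := Affine.Simplex.dist_circumcenter_eq_circumradius
    (⟨![A, B, C], hABC⟩ : Affine.Triangle ℝ (EuclideanSpace ℝ (Fin 2)))
  have hX := four_smul_circumcenter_sub
    (⟨![A, B, C], hABC⟩ : Affine.Triangle ℝ (EuclideanSpace ℝ (Fin 2)))
  rw [← hO, ← hH, ← hX20] at hX
  rw [← hO] at hdist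
  have hAB : dist A O = dist B O := (hdist 0).trans (hdist 1).symm
  have hAC : dist A O = dist C O := (hdist 0).trans (hdist 2).symm
  replace hX : X20 = (4 : ℝ) • O - (A + B + C) := hX
  have hcol := affineIndependent_iff_not_collinear_set.1 hABC
  have hb' : b < c + a := by
    have := dist_lt_add_of_not_collinear hcol
    rwa [dist_comm A C, ← ha, ← hb, ← hc] at this
  have hc' : c < b + a := by
    have := dist_lt_add_of_not_collinear (A := A) (B := C) (C := B)
      (by rwa [Set.pair_comm C B])
    rwa [dist_comm A C, dist_comm C B, ← ha, ← hb, ← hc] at this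
  have ha' : a < c + b := by
    have := dist_lt_add_of_not_collinear (A := B) (B := A) (C := C)
      (by rwa [Set.insert_comm])
    rwa [dist_comm A C, dist_comm B A, ← ha, ← hb, ← hc] at this
  have hx : 0 < s - a := by linarith
  have hy : 0 < s - b := by linarith
  have hz : 0 < s - c := by linarith
  have hs0 : 0 < s := by linarith
  have hx' : a - s ≠ 0 := by linarith
  have hy' : b - s ≠ 0 := by linarith
  have hz' : c - s ≠ 0 := by linarith
  have hxy := mul_pos hx hy
  have hyz := mul_pos hy hz
  have hzx := mul_pos hz hx
  have ha2 : a ^ 2 = dist B C ^ 2 := by rw [ha]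
  have hb2 : b ^ 2 = dist C A ^ 2 := by rw [hb]
  have hc2 : c ^ 2 = dist A B ^ 2 := by rw [hc]
  rw [hX, hI, hGe, hEA, hEB, hEC, hGA, hGB, hGC]
  refine ⟨?_, ?_, ?_, ?_⟩
  · have hG := bary_smul A B C (mul_pos hxy hz).ne' (1 / (s - a)) (1 / (s - b)) (1 / (s - c))
    rw [← hG]
    convert deLongchamps_mem_affineSpan_pair (s := s) (x := s - a) (y := s - b) (z := s - c)
      (by linarith) (by linarith) (by linarith) (by linarith) hs0.ne' hx.ne' hy.ne' hz.ne'
      (by positivity) ha2 hb2 hc2 hAB hAC using 4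
    congr 1 <;> field_simp
  · convert deLongchamps_mem_affineSpan_pair (a := -a) (s := s - a) (x := s) (y := c - s)
      (z := b - s) (by linarith) (by linarith) (by linarith) (by linarith) hx.ne' hs0.ne' hz' hy'
      (by nlinarith) (by rwa [neg_sq]) hb2 hc2 hAB hAC using 4
    congr 1 <;> ring
  · convert deLongchamps_mem_affineSpan_pair (b := -b) (s := s - b) (x := c - s) (y := s)
      (z := a - s) (by linarith) (by linarith) (by linarith) (by linarith) hy.ne' hz' hs0.ne' hx'
      (by nlinarith) ha2 (by rwa [neg_sq]) hc2 hAB hAC using 4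
    congr 1 <;> ring
  · convert deLongchamps_mem_affineSpan_pair (c := -c) (s := s - c) (x := b - s) (y := a - s)
      (z := s) (by linarith) (by linarith) (by linarith) (by linarith) hz.ne' hy' hx' hs0.ne'
      (by nlinarith) ha2 hb2 (by rwa [neg_sq]) hAB hAC using 4
    congr 1 <;> ring
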